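/- arXiv:math/0605059 — 7 statements merged into one kernel-verified Lean document; each statement's English description precedes it below -/
import Mathlib

section
/- Let α₁, α₂ : ℝ → ℝ be smooth functions with α₁(0) = α₂(0) = 0, α₁'(0) = 1/2, α₂'(0) = 0, α₁''(0) = 0, α₂''(0) = 1/3. Define the polynomial F(y₁,y₂) = (2/3)y₁² + 2α₂⁽³⁾(0)·y₁y₂ − (4α₁⁽³⁾(0) + 6(α₂⁽³⁾(0))² − (3/2)α₂⁽⁴⁾(0))·y₂² − y₂. Then the function t ↦ F(α₁(t), α₂(t)) vanishes together with all its derivatives up to order 4 at t = 0; that is, the quadric F = 0 has contact of order four with the curve t ↦ (α₁(t), α₂(t)) at the origin. -/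
/-- Existence/contact part of Lemma 2.1: under the normalization assumptions
`α₁(0) = α₂(0) = 0`, `α₁'(0) = 1/2`, `α₂'(0) = 0`, `α₁''(0) = 0`, `α₂''(0) = 1/3`,
the quadric
`F(y₁,y₂) = (2/3)y₁² + 2α₂⁽³⁾(0) y₁y₂ − (4α₁⁽³⁾(0) + 6(α₂⁽³⁾(0))² − (3/2)α₂⁽⁴⁾(0)) y₂² − y₂ = 0`
has contact of order four with the curve `t ↦ (α₁(t), α₂(t))` at the origin. -/
theorem osculating_quadric_contact (α₁ α₂ : ℝ → ℝ)
    (hα₁ : ContDiff ℝ (⊤ : ℕ∞) α₁) (hα₂ : ContDiff ℝ (⊤ : ℕ∞) α₂)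
    (h10 : α₁ 0 = 0) (h20 : α₂ 0 = 0)
    (h11 : deriv α₁ 0 = 1/2) (h21 : deriv α₂ 0 = 0)
    (h12 : iteratedDeriv 2 α₁ 0 = 0) (h22 : iteratedDeriv 2 α₂ 0 = 1/3) :
    ∀ n ≤ 4, iteratedDeriv n (fun t =>
        (2/3) * (α₁ t)^2 + 2 * iteratedDeriv 3 α₂ 0 * (α₁ t) * (α₂ t)
          - (4 * iteratedDeriv 3 α₁ 0 + 6 * (iteratedDeriv 3 α₂ 0)^2
              - (3/2) * iteratedDeriv 4 α₂ 0) * (α₂ t)^2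
          - α₂ t) 0 = 0 := by
  intro n hn
  have h₁ : ContDiffAt ℝ n α₁ 0 := (hα₁.of_le (by exact_mod_cast le_top)).contDiffAt
  have h₂ : ContDiffAt ℝ n α₂ 0 := (hα₂.of_le (by exact_mod_cast le_top)).contDiffAt
  generalize hb : iteratedDeriv 3 α₂ 0 = b
  generalize hk : 4 * iteratedDeriv 3 α₁ 0 + 6 * b ^ 2 - (3/2) * iteratedDeriv 4 α₂ 0 = k
  simp only [mul_assoc, pow_two]
  rw [iteratedDeriv_fun_sub (by fun_prop) h₂, iteratedDeriv_fun_sub (by fun_prop) (by fun_prop),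
    iteratedDeriv_fun_add (by fun_prop) (by fun_prop)]
  simp only [iteratedDeriv_const_mul_field]
  rw [iteratedDeriv_fun_mul h₁ h₁, iteratedDeriv_fun_mul h₁ h₂, iteratedDeriv_fun_mul h₂ h₂]
  rw [← iteratedDeriv_one] at h11 h21
  interval_cases n <;>
    simp [Finset.sum_range_succ, Nat.choose, h10, h20, h11, h21, h12, h22, hb] <;>
    linarith
end

section
/- Let α₁, α₂ : ℝ → ℝ be smooth functions with α₁(0) = α₂(0) = 0, α₁'(0) = 1/2, α₂'(0) = 0, α₁''(0) = 0, α₂''(0) = 1/3. Suppose G(y₁,y₂) = A·y₁² + B·y₁y₂ + C·y₂² + D·y₁ + E·y₂ + K is a real polynomial of degree at most 2 such that the function t ↦ G(α₁(t), α₂(t)) vanishes together with all its derivatives up to order 4 at t = 0. Then G is a real scalar multiple of the polynomial F(y₁,y₂) = (2/3)y₁² + 2α₂⁽³⁾(0)·y₁y₂ − (4α₁⁽³⁾(0) + 6(α₂⁽³⁾(0))² − (3/2)α₂⁽⁴⁾(0))·y₂² − y₂. -/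
/-- The iterated derivatives of a quadratic polynomial in two smooth functions, by the Leibniz rule. -/
theorem iteratedDeriv_quadratic_comp {f g : ℝ → ℝ} {n : ℕ} {x : ℝ}
    (hf : ContDiffAt ℝ n f x) (hg : ContDiffAt ℝ n g x) (A B C D E K : ℝ) :
    iteratedDeriv n (fun t =>
        A * (f t)^2 + B * (f t) * (g t) + C * (g t)^2 + D * f t + E * g t + K) x
      = A * (∑ i ∈ Finset.range (n + 1),
            n.choose i * iteratedDeriv i f x * iteratedDeriv (n - i) f x)
        + B * (∑ i ∈ Finset.range (n + 1),
            n.choose i * iteratedDeriv i f x * iteratedDeriv (n - i) g x)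
        + C * (∑ i ∈ Finset.range (n + 1),
            n.choose i * iteratedDeriv i g x * iteratedDeriv (n - i) g x)
        + D * iteratedDeriv n f x + E * iteratedDeriv n g x
        + iteratedDeriv n (fun _ => K) x := by
  simp only [pow_two, mul_assoc B]
  rw [iteratedDeriv_fun_add (by fun_prop) (by fun_prop),
    iteratedDeriv_fun_add (by fun_prop) (by fun_prop),
    iteratedDeriv_fun_add (by fun_prop) (by fun_prop),
    iteratedDeriv_fun_add (by fun_prop) (by fun_prop),
    iteratedDeriv_fun_add (by fun_prop) (by fun_prop)]
  simp only [iteratedDeriv_const_mul_field, iteratedDeriv_fun_mul hf hf,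
    iteratedDeriv_fun_mul hf hg, iteratedDeriv_fun_mul hg hg]

/-- Uniqueness part of Lemma 2.1: under the normalization assumptions, any quadratic
polynomial `G(y₁,y₂) = A y₁² + B y₁y₂ + C y₂² + D y₁ + E y₂ + K` whose composition with
the curve `t ↦ (α₁(t), α₂(t))` vanishes together with its derivatives up to order 4 at
`t = 0` is a real scalar multiple of
`F(y₁,y₂) = (2/3)y₁² + 2α₂⁽³⁾(0) y₁y₂ − (4α₁⁽³⁾(0) + 6(α₂⁽³⁾(0))² − (3/2)α₂⁽⁴⁾(0)) y₂² − y₂`. -/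
theorem osculating_quadric_unique (α₁ α₂ : ℝ → ℝ)
    (hα₁ : ContDiff ℝ (⊤ : ℕ∞) α₁) (hα₂ : ContDiff ℝ (⊤ : ℕ∞) α₂)
    (h10 : α₁ 0 = 0) (h20 : α₂ 0 = 0)
    (h11 : deriv α₁ 0 = 1/2) (h21 : deriv α₂ 0 = 0)
    (h12 : iteratedDeriv 2 α₁ 0 = 0) (h22 : iteratedDeriv 2 α₂ 0 = 1/3)
    (A B C D E K : ℝ)
    (hcontact : ∀ n ≤ 4, iteratedDeriv n (fun t =>
        A * (α₁ t)^2 + B * (α₁ t) * (α₂ t) + C * (α₂ t)^2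
          + D * α₁ t + E * α₂ t + K) 0 = 0) :
    ∃ c : ℝ, ∀ y₁ y₂ : ℝ,
      A * y₁^2 + B * y₁ * y₂ + C * y₂^2 + D * y₁ + E * y₂ + K
        = c * ((2/3) * y₁^2 + 2 * iteratedDeriv 3 α₂ 0 * y₁ * y₂
            - (4 * iteratedDeriv 3 α₁ 0 + 6 * (iteratedDeriv 3 α₂ 0)^2
                - (3/2) * iteratedDeriv 4 α₂ 0) * y₂^2
            - y₂) := by
  have key (n : ℕ) (hn : n ≤ 4) := (iteratedDeriv_quadratic_comp
    (hα₁.contDiffAt.of_le (by exact_mod_cast le_top))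
    (hα₂.contDiffAt.of_le (by exact_mod_cast le_top)) A B C D E K).symm.trans (hcontact n hn)
  have e0 := key 0 (by norm_num)
  have e1 := key 1 (by norm_num)
  have e2 := key 2 (by norm_num)
  have e3 := key 3 (by norm_num)
  have e4 := key 4 (by norm_num)
  simp [Finset.sum_range_succ, iteratedDeriv_const, Nat.choose, h10, h20, h11, h21, h12, h22]
    at e0 e1 e2 e3 e4
  have hA : A = -(2 / 3) * E := by linarith
  have hB : B = -2 * E * iteratedDeriv 3 α₂ 0 := by
    rw [e1] at e3
    linarith
  have hC : C = E * (4 * iteratedDeriv 3 α₁ 0 + 6 * (iteratedDeriv 3 α₂ 0)^2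
      - (3/2) * iteratedDeriv 4 α₂ 0) := by
    rw [hA, hB, e1] at e4
    linarith
  refine ⟨-E, fun y₁ y₂ => ?_⟩
  rw [e0, e1, hA, hB, hC]
  ring
end

section
/- Let V be a real vector space of dimension k ≥ 2, I ⊆ ℝ an open interval, and ε : I → V a smooth curve such that for every t ∈ I the vectors ε(t), ε'(t), …, ε⁽ᵏ⁻¹⁾(t) form a basis of V. Then there exists a smooth nowhere-vanishing function f : I → ℝ such that the curve εf := f·ε satisfies: for every t ∈ I, (εf)⁽ᵏ⁾(t) lies in the span of (εf)(t), (εf)'(t), …, (εf)⁽ᵏ⁻²⁾(t). Moreover, if g : I → ℝ is another smooth nowhere-vanishing function with this property, then g = c·f for some nonzero real constant c. -/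
open scoped ContDiff

/-- The coordinates of a smooth curve with respect to a smooth moving frame are smooth. -/
theorem ContDiffOn.exists_coord_of_frame {ι V : Type*} [Fintype ι] [NormedAddCommGroup V]
    [NormedSpace ℝ V] {n : ℕ∞ω} {s : Set ℝ} {v : ι → ℝ → V} {u : ℝ → V}
    (hv : ∀ i, ContDiffOn ℝ n (v i) s) (hu : ContDiffOn ℝ n u s)
    (hli : ∀ t ∈ s, LinearIndependent ℝ fun i => v i t)
    (hspan : ∀ t ∈ s, Submodule.span ℝ (Set.range fun i => v i t) = ⊤) :
    ∃ a : ι → ℝ → ℝ, (∀ i, ContDiffOn ℝ n (a i) s) ∧ ∀ t ∈ s, u t = ∑ i, a i t • v i t := by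
  classical
  let T : ℝ → (ι → ℝ) →L[ℝ] V := fun t =>
    ∑ i, (ContinuousLinearMap.proj (R := ℝ) (φ := fun _ : ι => ℝ) i).smulRight (v i t)
  have hT : ∀ t x, T t x = ∑ i, x i • v i t := fun t x => by simp [T]
  have hTs : ContDiffOn ℝ n T s := by
    refine ContDiffOn.sum fun i _ => ?_
    exact ((ContinuousLinearMap.smulRightL ℝ (ι → ℝ) V
      (ContinuousLinearMap.proj i)).contDiff).comp_contDiffOn (hv i)
  have hinv : ∀ t ∈ s, (T t).IsInvertible := fun t ht => by
    let b := Module.Basis.mk (hli t ht) (hspan t ht).ge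
    refine ⟨b.equivFun.symm.toContinuousLinearEquiv, ?_⟩
    ext1 x
    simp [hT, b, Module.Basis.equivFun_symm_apply]
  have hc : ContDiffOn ℝ n (fun t => (T t).inverse (u t)) s := by
    refine ContDiffOn.clm_apply (fun t ht => ?_) hu
    exact (hinv t ht).contDiffAt_map_inverse.comp_contDiffWithinAt t (hTs t ht)
  refine ⟨fun i t => (T t).inverse (u t) i, fun i => contDiffOn_pi.1 hc i, fun t ht => ?_⟩
  rw [← hT, (hinv t ht).self_apply_inverse]

theorem ContDiffOn.iteratedDerivWithin_of_isOpen {V : Type*} [NormedAddCommGroup V]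
    [NormedSpace ℝ V] {s : Set ℝ} (hs : IsOpen s) {u : ℝ → V} (hu : ContDiffOn ℝ ∞ u s) (m : ℕ) :
    ContDiffOn ℝ ∞ (iteratedDerivWithin m u s) s := by
  induction m generalizing u with
  | zero => simpa using hu
  | succ m ih =>
    rw [iteratedDerivWithin_succ']
    exact ih (hu.derivWithin hs.uniqueDiffOn le_rfl)

/-- A smooth function on an open interval has a smooth antiderivative. -/
theorem ContDiffOn.exists_antideriv {s : Set ℝ} (hs : IsOpen s) (hc : s.OrdConnected)
    {a : ℝ → ℝ} (ha : ContDiffOn ℝ ∞ a s) :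
    ∃ A : ℝ → ℝ, ContDiffOn ℝ ∞ A s ∧ ∀ t ∈ s, HasDerivAt A (a t) t := by
  obtain rfl | ⟨t₀, ht₀⟩ := s.eq_empty_or_nonempty
  · exact ⟨0, contDiffOn_empty, by simp⟩
  have hd : ∀ t ∈ s, HasDerivAt (fun u => ∫ x in t₀..u, a x) (a t) t := fun t ht =>
    intervalIntegral.integral_hasDerivAt_right
      ((ha.continuousOn.mono (hc.uIcc_subset ht₀ ht)).intervalIntegrable)
      (ha.continuousOn.stronglyMeasurableAtFilter hs t ht)
      (ha.continuousOn.continuousAt (hs.mem_nhds ht))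
  refine ⟨_, (contDiffOn_infty_iff_deriv_of_isOpen hs).2 ⟨fun t ht =>
    (hd t ht).differentiableAt.differentiableWithinAt, ha.congr fun t ht => (hd t ht).deriv⟩, hd⟩

section LinearAlgebra

variable {V : Type*} [AddCommGroup V] [Module ℝ V]

theorem mem_span_range_fin {v : ℕ → V} {i j : ℕ} (h : i < j) :
    v i ∈ Submodule.span ℝ (Set.range fun i : Fin j => v i) :=
  Submodule.subset_span ⟨⟨i, h⟩, rfl⟩

theorem span_range_fin_mono (v : ℕ → V) {i j : ℕ} (h : i ≤ j) :
    Submodule.span ℝ (Set.range fun i : Fin i => v i) ≤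
      Submodule.span ℝ (Set.range fun i : Fin j => v i) :=
  Submodule.span_le.2 <| by
    rintro _ ⟨l, rfl⟩
    exact mem_span_range_fin (l.2.trans_le h)

/-- A triangular change of sequence with nonzero diagonal preserves the spans of the initial
segments. -/
theorem span_range_fin_eq_of_triangular {v w : ℕ → V} {c : ℝ} (hc : c ≠ 0)
    (h : ∀ m, w m - c • v m ∈ Submodule.span ℝ (Set.range fun i : Fin m => v i)) (j : ℕ) :
    Submodule.span ℝ (Set.range fun i : Fin j => w i) =
      Submodule.span ℝ (Set.range fun i : Fin j => v i) := by
  apply le_antisymm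
  · rw [Submodule.span_le]
    rintro _ ⟨⟨i, hi⟩, rfl⟩
    have := add_mem (span_range_fin_mono v hi.le (h i))
      (Submodule.smul_mem _ c (mem_span_range_fin (v := v) hi))
    simpa using this
  · induction j with
    | zero => simp
    | succ j ih =>
      rw [Submodule.span_le]
      rintro _ ⟨⟨i, hi⟩, rfl⟩
      have h1 : w i - c • v i ∈ Submodule.span ℝ (Set.range fun i : Fin (j + 1) => w i) :=
        span_range_fin_mono w j.le_succ (ih (span_range_fin_mono v (Nat.lt_succ_iff.1 hi) (h i)))
      have h2 := Submodule.smul_mem _ c⁻¹ (sub_mem (mem_span_range_fin (v := w) hi) h1)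
      simpa [smul_smul, hc] using h2

end LinearAlgebra

section Leibniz

variable {V : Type*} [NormedAddCommGroup V] [NormedSpace ℝ V] {s : Set ℝ} {f : ℝ → ℝ}
  {ε : ℝ → V} {t : ℝ}

theorem iteratedDerivWithin_succ_smul_sub_mem_span (hs : IsOpen s) (hf : ContDiffOn ℝ ∞ f s)
    (hε : ContDiffOn ℝ ∞ ε s) (ht : t ∈ s) (n : ℕ) :
    iteratedDerivWithin (n + 1) (fun x => f x • ε x) s t
        - (f t • iteratedDerivWithin (n + 1) ε s t
          + ((n + 1) * deriv f t) • iteratedDerivWithin n ε s t) ∈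
      Submodule.span ℝ (Set.range fun i : Fin n => iteratedDerivWithin (i : ℕ) ε s t) := by
  have key := iteratedDerivWithin_smul (n := n + 1) ht hs.uniqueDiffOn
    ((hf t ht).of_le (by exact_mod_cast le_top)) ((hε t ht).of_le (by exact_mod_cast le_top))
  change iteratedDerivWithin (n + 1) (fun x => f x • ε x) s t = _ at key
  rw [key, Finset.sum_range_succ', Finset.sum_range_succ']
  have h1 : derivWithin f s t = deriv f t := derivWithin_of_isOpen hs ht
  have : ∀ r x y z : V, y = z → r + y + x - (x + z) = r := by
    rintro r x y _ rfl
    abel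
  simp only [zero_add, Nat.choose_one_right, iteratedDerivWithin_one, h1, Nat.choose_zero_right,
    one_smul, iteratedDerivWithin_zero, Nat.sub_zero, Nat.add_sub_cancel]
  rw [this _ _ _ _ (by rw [← Nat.cast_smul_eq_nsmul ℝ, smul_smul]; push_cast; rfl)]
  refine Submodule.sum_mem _ fun i hi => ?_
  refine nsmul_mem (Submodule.smul_mem _ _ ?_) _
  exact mem_span_range_fin (v := fun m => iteratedDerivWithin m ε s t)
    (by have := Finset.mem_range.1 hi; omega)

theorem iteratedDerivWithin_smul_sub_mem_span (hs : IsOpen s) (hf : ContDiffOn ℝ ∞ f s)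
    (hε : ContDiffOn ℝ ∞ ε s) (ht : t ∈ s) (m : ℕ) :
    iteratedDerivWithin m (fun x => f x • ε x) s t - f t • iteratedDerivWithin m ε s t ∈
      Submodule.span ℝ (Set.range fun i : Fin m => iteratedDerivWithin (i : ℕ) ε s t) := by
  cases m with
  | zero => simp
  | succ n =>
    have h1 := span_range_fin_mono (fun m => iteratedDerivWithin m ε s t) n.le_succ
      (iteratedDerivWithin_succ_smul_sub_mem_span hs hf hε ht n)
    have h2 := Submodule.smul_mem _ ((n + 1) * deriv f t) (mem_span_range_fin
      (v := fun m => iteratedDerivWithin m ε s t) n.lt_succ_self)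
    convert add_mem h1 h2 using 1
    module

/-- The rescaled curve `f • ε` is canonical at `t` if and only if `f` satisfies a first-order
linear differential equation at `t`. -/
theorem iteratedDerivWithin_smul_mem_span_iff (hs : IsOpen s) (hf : ContDiffOn ℝ ∞ f s)
    (hε : ContDiffOn ℝ ∞ ε s) (ht : t ∈ s) (hft : f t ≠ 0) {n : ℕ}
    (hli : LinearIndependent ℝ fun i : Fin (n + 1) => iteratedDerivWithin (i : ℕ) ε s t)
    {a : Fin (n + 1) → ℝ}
    (ha : iteratedDerivWithin (n + 1) ε s t = ∑ i, a i • iteratedDerivWithin (i : ℕ) ε s t) :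
    iteratedDerivWithin (n + 1) (fun x => f x • ε x) s t ∈
        Submodule.span ℝ (Set.range fun i : Fin n =>
          iteratedDerivWithin (i : ℕ) (fun x => f x • ε x) s t) ↔
      (n + 1) * deriv f t + a (Fin.last n) * f t = 0 := by
  rw [span_range_fin_eq_of_triangular (v := fun m => iteratedDerivWithin m ε s t)
    (w := fun m => iteratedDerivWithin m (fun x => f x • ε x) s t) hft
    (iteratedDerivWithin_smul_sub_mem_span hs hf hε ht) n]
  set S := Submodule.span ℝ (Set.range fun i : Fin n => iteratedDerivWithin (i : ℕ) ε s t)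
  have hnot : iteratedDerivWithin n ε s t ∉ S := by
    have := (linearIndependent_finSucc'.1 hli).2
    simpa [Fin.init_def] using this
  have h1 := iteratedDerivWithin_succ_smul_sub_mem_span hs hf hε ht n
  have h2 : iteratedDerivWithin (n + 1) ε s t - a (Fin.last n) • iteratedDerivWithin n ε s t ∈
      S := by
    rw [ha, Fin.sum_univ_castSucc]
    simp only [Fin.val_last, Fin.val_castSucc, add_sub_cancel_right]
    exact Submodule.sum_mem _ fun i _ => Submodule.smul_mem _ _ (Submodule.subset_span ⟨i, rfl⟩)
  have h3 : iteratedDerivWithin (n + 1) (fun x => f x • ε x) s t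
      - ((n + 1) * deriv f t + a (Fin.last n) * f t) • iteratedDerivWithin n ε s t ∈ S := by
    convert add_mem h1 (Submodule.smul_mem _ (f t) h2) using 1
    module
  constructor
  · intro h
    by_contra hne
    have := sub_mem h h3
    rw [sub_sub_cancel] at this
    exact hnot ((Submodule.smul_mem_iff _ hne).1 this)
  · intro h
    simpa [h] using h3

end Leibniz


/-- Existence and uniqueness (up to a nonzero constant factor) of the canonical
representative of a regular curve in projective space: if `ε : I → V` is smooth and
`ε(t), ε'(t), …, ε⁽ᵏ⁻¹⁾(t)` form a basis of the `k`-dimensional space `V` for all `t ∈ I`,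
then there is a smooth nowhere-vanishing `f : I → ℝ` such that `(fε)⁽ᵏ⁾(t)` lies in the
span of `(fε)(t), …, (fε)⁽ᵏ⁻²⁾(t)` for all `t ∈ I`, and any other such `g` is a nonzero
constant multiple of `f`. -/
theorem canonical_representative_exists_unique
    {V : Type*} [NormedAddCommGroup V] [NormedSpace ℝ V] [FiniteDimensional ℝ V]
    (k : ℕ) (hk : 2 ≤ k) (hdim : Module.finrank ℝ V = k)
    (I : Set ℝ) (hIopen : IsOpen I) (hIconn : I.OrdConnected)
    (ε : ℝ → V) (hε : ContDiffOn ℝ (⊤ : ℕ∞) ε I)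
    (hreg : ∀ t ∈ I,
      LinearIndependent ℝ (fun i : Fin k => iteratedDerivWithin (i : ℕ) ε I t) ∧
      Submodule.span ℝ (Set.range fun i : Fin k => iteratedDerivWithin (i : ℕ) ε I t) = ⊤) :
    ∃ f : ℝ → ℝ, ContDiffOn ℝ (⊤ : ℕ∞) f I ∧ (∀ t ∈ I, f t ≠ 0) ∧
      (∀ t ∈ I, iteratedDerivWithin k (fun s => f s • ε s) I t ∈
        Submodule.span ℝ (Set.range fun i : Fin (k - 1) =>
          iteratedDerivWithin (i : ℕ) (fun s => f s • ε s) I t)) ∧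
      ∀ g : ℝ → ℝ, ContDiffOn ℝ (⊤ : ℕ∞) g I → (∀ t ∈ I, g t ≠ 0) →
        (∀ t ∈ I, iteratedDerivWithin k (fun s => g s • ε s) I t ∈
          Submodule.span ℝ (Set.range fun i : Fin (k - 1) =>
            iteratedDerivWithin (i : ℕ) (fun s => g s • ε s) I t)) →
        ∃ c : ℝ, c ≠ 0 ∧ ∀ t ∈ I, g t = c * f t := by
  obtain ⟨n, rfl⟩ : ∃ n, k = n + 1 := ⟨k - 1, by omega⟩
  obtain ⟨a, ha, hrel⟩ := ContDiffOn.exists_coord_of_frame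
    (v := fun (i : Fin (n + 1)) t => iteratedDerivWithin (i : ℕ) ε I t)
    (fun i => hε.iteratedDerivWithin_of_isOpen hIopen i)
    (hε.iteratedDerivWithin_of_isOpen hIopen (n + 1))
    (fun t ht => (hreg t ht).1) (fun t ht => (hreg t ht).2)
  obtain ⟨A, hA, hdA⟩ := (ha (Fin.last n)).exists_antideriv hIopen hIconn
  have hn : (n + 1 : ℝ) ≠ 0 := by positivity
  let f : ℝ → ℝ := fun t => Real.exp (-(A t / (n + 1)))
  have hf : ContDiffOn ℝ ∞ f I := (hA.div_const _).neg.exp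
  have hdf : ∀ t ∈ I, HasDerivAt f (f t * -(a (Fin.last n) t / (n + 1))) t := fun t ht =>
    ((hdA t ht).div_const _).neg.exp
  have hf0 : ∀ t, f t ≠ 0 := fun t => (Real.exp_pos _).ne'
  refine ⟨f, hf, fun t _ => hf0 t, fun t ht => ?_, fun g hg hg0 hgc => ?_⟩
  · refine (iteratedDerivWithin_smul_mem_span_iff hIopen hf hε ht (hf0 t) (hreg t ht).1
      (hrel t ht)).2 ?_
    rw [(hdf t ht).deriv]
    field_simp
    ring
  · have hdg : ∀ t ∈ I, HasDerivAt g (deriv g t) t := fun t ht =>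
      ((hg.contDiffAt (hIopen.mem_nhds ht)).differentiableAt (by simp)).hasDerivAt
    have hq : ∀ t ∈ I, HasDerivAt (fun x => g x / f x) 0 t := fun t ht => by
      have hode := (iteratedDerivWithin_smul_mem_span_iff hIopen hg hε ht (hg0 t ht)
        (hreg t ht).1 (hrel t ht)).1 (hgc t ht)
      have hnum : deriv g t * f t - g t * (f t * -(a (Fin.last n) t / (n + 1))) = 0 := by
        field_simp
        linear_combination f t * hode
      simpa only [hnum, zero_div] using (hdg t ht).fun_div (hdf t ht) (hf0 t)
    obtain ⟨c, hc⟩ := hIopen.exists_is_const_of_deriv_eq_zero hIconn.isPreconnected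
      (fun t ht => (hq t ht).differentiableAt.differentiableWithinAt) (fun t ht => (hq t ht).deriv)
    obtain rfl | ⟨t₀, ht₀⟩ := I.eq_empty_or_nonempty
    · exact ⟨1, one_ne_zero, by simp⟩
    · refine ⟨c, ?_, fun t ht => ?_⟩
      · rw [← hc t₀ ht₀]
        exact div_ne_zero (hg0 t₀ ht₀) (hf0 t₀)
      · rw [← hc t ht, div_mul_cancel₀ _ (hf0 t)]
end

section
/- Let V be a real vector space of dimension 2m (m ≥ 1) equipped with a nondegenerate alternating bilinear form ω, let I ⊆ ℝ be an open interval, and let ε : I → V be a smooth curve such that for every t ∈ I the vectors ε(t), ε'(t), …, ε⁽²ᵐ⁻¹⁾(t) form a basis of V, and such that ω(ε⁽ⁱ⁾(t), ε⁽ʲ⁾(t)) = 0 for all 0 ≤ i, j ≤ m−1 and all t ∈ I. Then the following are equivalent: (a) for every t ∈ I, ε⁽²ᵐ⁾(t) lies in the span of ε(t), ε'(t), …, ε⁽²ᵐ⁻²⁾(t); (b) the function t ↦ ω(ε⁽ᵐ⁾(t), ε⁽ᵐ⁻¹⁾(t)) is constant on I. -/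
/-- If `f` has derivative `f'` at a point of an open set on which `f` agrees with `g`,
and `g` has derivative `g'` there, then `f' = g'`. -/
theorem HasDerivAt.unique_of_eqOn {I : Set ℝ} (hI : IsOpen I) {f g : ℝ → ℝ} {f' g' t : ℝ}
    (ht : t ∈ I) (hf : HasDerivAt f f' t) (hg : HasDerivAt g g' t) (hfg : Set.EqOn f g I) :
    f' = g' :=
  hf.unique (hg.congr_of_eventuallyEq (hfg.eventuallyEq_of_mem (hI.mem_nhds ht)))

section LeibnizArray

variable {I : Set ℝ} {n : ℕ} {w : ℕ → ℕ → ℝ → ℝ}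

/-- An array of functions obeying the Leibniz rule and vanishing on the square `i, j ≤ n`
vanishes on the triangle `i + j ≤ 2 * n`. -/
theorem leibniz_array_eq_zero (hI : IsOpen I)
    (hw : ∀ i j, ∀ t ∈ I, HasDerivAt (w i j) (w (i + 1) j t + w i (j + 1) t) t)
    (hlag : ∀ t ∈ I, ∀ i ≤ n, ∀ j ≤ n, w i j t = 0) (i : ℕ) :
    ∀ j ≤ n, i + j ≤ 2 * n → ∀ t ∈ I, w i j t = 0 := by
  induction i with
  | zero => intro j hj _ t ht; exact hlag t ht 0 (Nat.zero_le _) j hj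
  | succ i ih =>
    intro j hj hij t ht
    by_cases hi : i + 1 ≤ n
    · exact hlag t ht _ hi j hj
    · have h := (hw i j t ht).unique_of_eqOn hI ht (hasDerivAt_const t (0 : ℝ))
        (fun s hs => ih j hj (by omega) s hs)
      have h' := ih (j + 1) (by omega) (by omega) t ht
      linarith

/-- Along the antidiagonal `i + j = 2 * n + 1` the entries agree up to alternating signs. -/
theorem leibniz_array_antidiagonal (hI : IsOpen I)
    (hw : ∀ i j, ∀ t ∈ I, HasDerivAt (w i j) (w (i + 1) j t + w i (j + 1) t) t)
    (hlag : ∀ t ∈ I, ∀ i ≤ n, ∀ j ≤ n, w i j t = 0) (k : ℕ) :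
    ∀ j, k + j = n → ∀ t ∈ I, w (n + 1 + k) j t = (-1) ^ k * w (n + 1) n t := by
  induction k with
  | zero => intro j hj t _; obtain rfl : j = n := by omega
            simp
  | succ k ih =>
    intro j hj t ht
    have h := (hw (n + 1 + k) j t ht).unique_of_eqOn hI ht (hasDerivAt_const t (0 : ℝ))
      (fun s hs => leibniz_array_eq_zero hI hw hlag _ j (by omega) (by omega) s hs)
    have h' := ih (j + 1) (by omega) t ht
    rw [← add_assoc, pow_succ]
    linarith

/-- Along the antidiagonal `i + j = 2 * n + 2` the entries are multiples of the derivative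
of the central entry `w (n + 1) n`. -/
theorem leibniz_array_antidiagonal_succ (hI : IsOpen I)
    (hw : ∀ i j, ∀ t ∈ I, HasDerivAt (w i j) (w (i + 1) j t + w i (j + 1) t) t)
    (hlag : ∀ t ∈ I, ∀ i ≤ n, ∀ j ≤ n, w i j t = 0)
    (hdiag : ∀ t ∈ I, w (n + 1) (n + 1) t = 0) (k : ℕ) :
    ∀ j, k + j = n + 1 → ∀ t ∈ I,
      w (n + 1 + k) j t = -(-1) ^ k * k * deriv (w (n + 1) n) t := by
  induction k with
  | zero => intro j hj t ht; obtain rfl : j = n + 1 := by omega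
            simpa using hdiag t ht
  | succ k ih =>
    intro j hj t ht
    have h := (hw (n + 1 + k) j t ht).unique_of_eqOn hI ht
      ((hw (n + 1) n t ht).differentiableAt.hasDerivAt.const_mul ((-1) ^ k))
      (fun s hs => leibniz_array_antidiagonal hI hw hlag k j (by omega) s hs)
    have h' := ih (j + 1) (by omega) t ht
    rw [← add_assoc, pow_succ]
    push_cast
    linarith

end LeibnizArray

/-- If a linear functional kills all but the last of the `N + 1` spanning vectors `e i`, but is
not zero on the last one, then its kernel is the span of the first `N` vectors. -/
theorem mem_span_range_iff_of_apply_eq_zero {V : Type*} [AddCommGroup V] [Module ℝ V]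
    {N : ℕ} {e : ℕ → V} {φ : V →ₗ[ℝ] ℝ}
    (hspan : Submodule.span ℝ (Set.range fun i : Fin (N + 1) => e i) = ⊤)
    (hφ : ∀ i < N, φ (e i) = 0) (hφN : φ (e N) ≠ 0) (v : V) :
    v ∈ Submodule.span ℝ (Set.range fun i : Fin N => e i) ↔ φ v = 0 := by
  constructor
  · intro hv
    have hle : Submodule.span ℝ (Set.range fun i : Fin N => e i) ≤ LinearMap.ker φ := by
      rw [Submodule.span_le]
      rintro _ ⟨i, rfl⟩
      exact hφ i i.2
    exact hle hv
  · intro hv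
    have hmem : v ∈ Submodule.span ℝ (Set.range fun i : Fin (N + 1) => e i) :=
      hspan ▸ Submodule.mem_top
    obtain ⟨c, rfl⟩ := (Submodule.mem_span_range_iff_exists_fun ℝ).1 hmem
    rw [Fin.sum_univ_castSucc] at hv ⊢
    have hc : c (Fin.last N) = 0 := by
      simpa [map_add, map_sum, hφ, hφN] using hv
    rw [hc, zero_smul, add_zero]
    exact Submodule.sum_mem _ fun i _ =>
      Submodule.smul_mem _ _ (Submodule.subset_span ⟨i, rfl⟩)

/-- On an open set, the iterated derivatives of a smooth curve are successive derivatives. -/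
theorem ContDiffOn.hasDerivAt_iteratedDerivWithin {V : Type*} [NormedAddCommGroup V]
    [NormedSpace ℝ V] {I : Set ℝ} (hI : IsOpen I) {ε : ℝ → V}
    (hε : ContDiffOn ℝ (⊤ : ℕ∞) ε I) (i : ℕ) {t : ℝ} (ht : t ∈ I) :
    HasDerivAt (iteratedDerivWithin i ε I) (iteratedDerivWithin (i + 1) ε I t) t := by
  have hd : DifferentiableWithinAt ℝ (iteratedDerivWithin i ε I) I t :=
    hε.differentiableOn_iteratedDerivWithin (by exact_mod_cast ENat.natCast_lt_top i)
      hI.uniqueDiffOn t ht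
  rw [iteratedDerivWithin_succ]
  exact hd.hasDerivWithinAt.hasDerivAt (hI.mem_nhds ht)


/-- Remark 2.1, first claim: for a regular curve `ε` in a `2m`-dimensional symplectic
space `(V, ω)` whose osculating `m`-dimensional subspaces `span{ε(t), …, ε⁽ᵐ⁻¹⁾(t)}` are
Lagrangian, `ε` is a canonical representative (i.e. `ε⁽²ᵐ⁾(t)` lies in the span of
`ε(t), …, ε⁽²ᵐ⁻²⁾(t)` for all `t`) if and only if `t ↦ ω(ε⁽ᵐ⁾(t), ε⁽ᵐ⁻¹⁾(t))` is constant. -/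
theorem canonical_iff_symplectic_product_const
    {V : Type*} [NormedAddCommGroup V] [NormedSpace ℝ V] [FiniteDimensional ℝ V]
    (m : ℕ) (hm : 1 ≤ m) (hdim : Module.finrank ℝ V = 2 * m)
    (ω : V →ₗ[ℝ] V →ₗ[ℝ] ℝ) (halt : ∀ v : V, ω v v = 0)
    (hnd : ∀ v : V, (∀ w : V, ω v w = 0) → v = 0)
    (I : Set ℝ) (hIopen : IsOpen I) (hIconn : I.OrdConnected)
    (ε : ℝ → V) (hε : ContDiffOn ℝ (⊤ : ℕ∞) ε I)
    (hreg : ∀ t ∈ I,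
      LinearIndependent ℝ (fun i : Fin (2 * m) => iteratedDerivWithin (i : ℕ) ε I t) ∧
      Submodule.span ℝ
        (Set.range fun i : Fin (2 * m) => iteratedDerivWithin (i : ℕ) ε I t) = ⊤)
    (hlag : ∀ t ∈ I, ∀ i < m, ∀ j < m,
      ω (iteratedDerivWithin i ε I t) (iteratedDerivWithin j ε I t) = 0) :
    (∀ t ∈ I, iteratedDerivWithin (2 * m) ε I t ∈
        Submodule.span ℝ
          (Set.range fun i : Fin (2 * m - 1) => iteratedDerivWithin (i : ℕ) ε I t)) ↔
      ∃ c : ℝ, ∀ t ∈ I,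
        ω (iteratedDerivWithin m ε I t) (iteratedDerivWithin (m - 1) ε I t) = c := by
  obtain ⟨n, rfl⟩ : ∃ n, m = n + 1 := ⟨m - 1, by omega⟩
  set e : ℕ → ℝ → V := fun i => iteratedDerivWithin i ε I with he
  let w : ℕ → ℕ → ℝ → ℝ := fun i j t => ω (e i t) (e j t)
  have hw : ∀ i j, ∀ t ∈ I, HasDerivAt (w i j) (w (i + 1) j t + w i (j + 1) t) t := by
    intro i j t ht
    have h := (ω.toContinuousBilinearMap).hasFDerivAt_of_bilinear
      (hε.hasDerivAt_iteratedDerivWithin hIopen i ht).hasFDerivAt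
      (hε.hasDerivAt_iteratedDerivWithin hIopen j ht).hasFDerivAt
    simpa [w, he, add_comm] using h.hasDerivAt
  have hlag' : ∀ t ∈ I, ∀ i ≤ n, ∀ j ≤ n, w i j t = 0 := fun t ht i hi j hj =>
    hlag t ht i (by omega) j (by omega)
  have hlow : ∀ t ∈ I, ∀ i < 2 * n + 1, w i 0 t = 0 := fun t ht i hi =>
    leibniz_array_eq_zero hIopen hw hlag' i 0 (Nat.zero_le _) (by omega) t ht
  have hspan : ∀ t ∈ I,
      Submodule.span ℝ (Set.range fun i : Fin (2 * n + 1 + 1) => e i t) = ⊤ := fun t ht =>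
    (hreg t ht).2
  have htop : ∀ t ∈ I, w (2 * n + 1) 0 t ≠ 0 := by
    intro t ht h0
    have hker : LinearMap.ker (ω.flip (e 0 t)) = ⊤ := by
      rw [eq_top_iff, ← hspan t ht, Submodule.span_le]
      rintro _ ⟨i, rfl⟩
      rcases Nat.lt_succ_iff_lt_or_eq.1 i.2 with hi | hi
      · exact hlow t ht i hi
      · simpa [hi] using h0
    have hneg : ∀ x y, -ω x y = ω y x := LinearMap.IsAlt.neg halt
    refine (hreg t ht).1.ne_zero ⟨0, by omega⟩ (hnd _ fun x => ?_)
    have hx : ω x (e 0 t) = 0 := by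
      have : x ∈ LinearMap.ker (ω.flip (e 0 t)) := hker ▸ Submodule.mem_top
      simpa using this
    rw [← hneg]
    exact neg_eq_zero.2 hx
  have hlast : ∀ t ∈ I, (e (2 * (n + 1)) t ∈
      Submodule.span ℝ (Set.range fun i : Fin (2 * (n + 1) - 1) => e i t)) ↔
        deriv (w (n + 1) n) t = 0 := by
    intro t ht
    have h := leibniz_array_antidiagonal_succ hIopen hw hlag' (fun t _ => halt _) (n + 1) 0
      rfl t ht
    rw [← two_mul] at h
    have hmem := mem_span_range_iff_of_apply_eq_zero (e := fun i => e i t)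
      (φ := ω.flip (e 0 t)) (hspan t ht) (hlow t ht) (htop t ht) (e (2 * (n + 1)) t)
    refine hmem.trans ?_
    change w (2 * (n + 1)) 0 t = 0 ↔ _
    rw [h]
    have hn : (n : ℝ) + 1 ≠ 0 := by positivity
    simp [hn]
  rw [forall₂_congr hlast]
  constructor
  · intro h
    exact hIopen.exists_is_const_of_deriv_eq_zero hIconn.isPreconnected
      (fun t ht => (hw (n + 1) n t ht).differentiableAt.differentiableWithinAt) h
  · rintro ⟨c, hc⟩ t ht
    exact (hw (n + 1) n t ht).differentiableAt.hasDerivAt.unique_of_eqOn hIopen ht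
      (hasDerivAt_const t c) hc
end

section
/- Let V be a real vector space of dimension k ≥ 3, let I ⊆ ℝ be an open interval containing t₀, and let ε : I → V be a smooth curve such that for every t ∈ I the vectors ε(t), ε'(t), …, ε⁽ᵏ⁻¹⁾(t) form a basis of V. Let ℓ = span{ε(t₀)} and let Π : V → V/ℓ be the canonical projection. Then the map η defined by η(t) = (t−t₀)⁻¹·Π(ε(t)) for t ≠ t₀ and η(t₀) = Π(ε'(t₀)) is smooth in a neighborhood of t₀, and there is a neighborhood J of t₀ in I such that for every t ∈ J the vectors η(t), η'(t), …, η⁽ᵏ⁻²⁾(t) form a basis of the (k−1)-dimensional space V/ℓ. -/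
open Set Filter Topology MeasureTheory
open scoped Interval

section Hadamard

variable {E : Type*} [NormedAddCommGroup E] [NormedSpace ℝ E]

theorem Set.OrdConnected.add_mul_sub_mem {I : Set ℝ} (hI : I.OrdConnected) {a x r : ℝ}
    (ha : a ∈ I) (hx : x ∈ I) (hr : r ∈ Icc (0 : ℝ) 1) : a + r * (x - a) ∈ I := by
  have h := hI.convex.add_smul_sub_mem ha hx hr
  simpa using h

/-- Differentiation under the integral sign along the segments issuing from a base point. -/
theorem hasDerivAt_integral_pow_smul_segment {I : Set ℝ} (hI : IsOpen I) (hconn : I.OrdConnected)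
    {a x : ℝ} (ha : a ∈ I) (hx : x ∈ I) {g : ℝ → E} (hg : ContDiffOn ℝ 1 g I) (n : ℕ) :
    HasDerivAt (fun y => ∫ r in (0 : ℝ)..1, r ^ n • g (a + r * (y - a)))
      (∫ r in (0 : ℝ)..1, r ^ (n + 1) • deriv g (a + r * (x - a))) x := by
  obtain ⟨δ, hδ, hball⟩ := Metric.nhds_basis_closedBall.mem_iff.1 (hI.mem_nhds hx)
  have hcont {h : ℝ → E} (hh : ContinuousOn h I) (m : ℕ) :
      ContinuousOn (fun p : ℝ × ℝ => p.2 ^ m • h (a + p.2 * (p.1 - a))) (I ×ˢ Icc (0 : ℝ) 1) := by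
    refine (continuousOn_snd.pow m).smul (hh.comp (by fun_prop) ?_)
    exact fun p hp => hconn.add_mul_sub_mem ha hp.1 hp.2
  have hslice {h : ℝ → E} (hh : ContinuousOn h I) (m : ℕ) {y : ℝ} (hy : y ∈ I) :
      IntervalIntegrable (fun r => r ^ m • h (a + r * (y - a))) volume 0 1 := by
    refine ContinuousOn.intervalIntegrable_of_Icc zero_le_one ?_
    exact (hcont hh m).comp (f := fun r : ℝ => (y, r)) (by fun_prop) fun r hr => ⟨hy, hr⟩
  have hg' : ContinuousOn (deriv g) I := hg.continuousOn_deriv_of_isOpen hI le_rfl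
  obtain ⟨C, hC⟩ := ((isCompact_closedBall x δ).prod (isCompact_Icc (a := (0 : ℝ)) (b := 1))
    ).exists_bound_of_continuousOn ((hcont hg' (n + 1)).mono (prod_mono hball subset_rfl))
  have hmem {r : ℝ} (hr : r ∈ Ι (0 : ℝ) 1) : r ∈ Icc (0 : ℝ) 1 := by
    rw [uIoc_of_le zero_le_one] at hr
    exact Ioc_subset_Icc_self hr
  refine (intervalIntegral.hasDerivAt_integral_of_dominated_loc_of_deriv_le
    (F' := fun y r => r ^ (n + 1) • deriv g (a + r * (y - a))) (bound := fun _ => C)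
    (Metric.closedBall_mem_nhds x hδ) ?_ (hslice hg.continuousOn n hx)
    (hslice hg' (n + 1) hx).def'.aestronglyMeasurable ?_ (by simp) ?_).2
  · filter_upwards [hI.mem_nhds hx] with y hy
    exact (hslice hg.continuousOn n hy).def'.aestronglyMeasurable
  · exact .of_forall fun r hr y hy => hC (y, r) ⟨hy, hmem hr⟩
  · refine .of_forall fun r hr y hy => ?_
    have hz := hconn.add_mul_sub_mem ha (hball hy) (hmem hr)
    have hd : HasDerivAt g (deriv g (a + r * (y - a))) (a + r * (y - a)) :=
      ((hg.differentiableOn one_ne_zero).differentiableAt (hI.mem_nhds hz)).hasDerivAt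
    have hl : HasDerivAt (fun y : ℝ => a + r * (y - a)) r y := by
      simpa using (((hasDerivAt_id y).sub_const a).const_mul r).const_add a
    have h := (hd.scomp y hl).const_smul (r ^ n)
    rw [smul_smul, ← pow_succ] at h
    exact h

theorem contDiffOn_integral_pow_smul_segment {I : Set ℝ} (hI : IsOpen I) (hconn : I.OrdConnected)
    {a : ℝ} (ha : a ∈ I) {g : ℝ → E} (hg : ContDiffOn ℝ (⊤ : ℕ∞) g I) (n : ℕ) :
    ContDiffOn ℝ (⊤ : ℕ∞) (fun y => ∫ r in (0 : ℝ)..1, r ^ n • g (a + r * (y - a))) I := by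
  refine contDiffOn_infty.2 fun m => ?_
  induction m generalizing g n with
  | zero =>
    refine contDiffOn_zero.2 fun x hx => ?_
    exact (hasDerivAt_integral_pow_smul_segment hI hconn ha hx
      (hg.of_le (by exact_mod_cast le_top)) n).continuousAt.continuousWithinAt
  | succ m ih =>
    have hd : ∀ x ∈ I, HasDerivAt (fun y => ∫ r in (0 : ℝ)..1, r ^ n • g (a + r * (y - a)))
        (∫ r in (0 : ℝ)..1, r ^ (n + 1) • deriv g (a + r * (x - a))) x := fun x hx =>
      hasDerivAt_integral_pow_smul_segment hI hconn ha hx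
        (hg.of_le (by exact_mod_cast le_top)) n
    push_cast
    refine (contDiffOn_succ_iff_deriv_of_isOpen hI).2
      ⟨fun x hx => (hd x hx).differentiableAt.differentiableWithinAt, by simp, ?_⟩
    exact (ih (hg.deriv_of_isOpen hI (by simp)) (n + 1)).congr fun x hx => (hd x hx).deriv

/-- Hadamard's lemma: the divided difference of a smooth function is smooth. -/
theorem ContDiffOn.dslope_of_ordConnected [CompleteSpace E] {I : Set ℝ} (hI : IsOpen I)
    (hconn : I.OrdConnected) {a : ℝ} (ha : a ∈ I) {f : ℝ → E}
    (hf : ContDiffOn ℝ (⊤ : ℕ∞) f I) : ContDiffOn ℝ (⊤ : ℕ∞) (dslope f a) I := by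
  have hf' : ContDiffOn ℝ (⊤ : ℕ∞) (deriv f) I := hf.deriv_of_isOpen hI (by simp)
  refine (contDiffOn_integral_pow_smul_segment hI hconn ha hf' 0).congr fun x hx => ?_
  rcases eq_or_ne x a with rfl | hne
  · simp
  · have h := intervalIntegral.integral_unitInterval_deriv_eq_sub (f := f) (f' := deriv f)
      (z₀ := a) (z₁ := x - a)
      (hf'.continuousOn.comp (by fun_prop) fun r hr => hconn.add_mul_sub_mem ha hx hr)
      (fun r hr => ((hf.differentiableOn (by simp)).differentiableAt
        (hI.mem_nhds (hconn.add_mul_sub_mem ha hx hr))).hasDerivAt)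
    simp only [smul_eq_mul, add_sub_cancel] at h
    simp only [pow_zero, one_smul]
    rw [dslope_of_ne _ hne, slope_def_module, ← h, smul_smul,
      inv_mul_cancel₀ (sub_ne_zero.2 hne), one_smul]

theorem iteratedDerivWithin_succ_sub_smul {s : Set ℝ} (hs : UniqueDiffOn ℝ s) {g : ℝ → E}
    (hg : ContDiffOn ℝ (⊤ : ℕ∞) g s) (a : ℝ) (n : ℕ) {x : ℝ} (hx : x ∈ s) :
    iteratedDerivWithin (n + 1) (fun t => (t - a) • g t) s x =
      (x - a) • iteratedDerivWithin (n + 1) g s x +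
        ((n : ℝ) + 1) • iteratedDerivWithin n g s x := by
  have hd (m : ℕ) {y : ℝ} (hy : y ∈ s) : HasDerivWithinAt (iteratedDerivWithin m g s)
      (iteratedDerivWithin (m + 1) g s y) s y := by
    rw [iteratedDerivWithin_succ]
    exact (hg.differentiableOn_iteratedDerivWithin (by exact_mod_cast WithTop.coe_lt_top m) hs y
      hy).hasDerivWithinAt
  have hsmul (m : ℕ) {y : ℝ} (hy : y ∈ s) :
      HasDerivWithinAt (fun t => (t - a) • iteratedDerivWithin m g s t)
        ((y - a) • iteratedDerivWithin (m + 1) g s y + iteratedDerivWithin m g s y) s y := by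
    simpa using ((hasDerivWithinAt_id y s).sub_const a).fun_smul (hd m hy)
  induction n generalizing x with
  | zero =>
    rw [iteratedDerivWithin_succ]
    simpa using (hsmul 0 hx).derivWithin (hs x hx)
  | succ n ih =>
    rw [iteratedDerivWithin_succ, derivWithin_congr (fun y hy => ih hy) (ih hx),
      ((hsmul (n + 1) hx).fun_add ((hd n hx).fun_const_smul _)).derivWithin (hs x hx)]
    push_cast
    module

end Hadamard

theorem ContinuousLinearMap.iteratedDerivWithin_comp_left {E F : Type*} [NormedAddCommGroup E]
    [NormedSpace ℝ E] [NormedAddCommGroup F] [NormedSpace ℝ F] (L : E →L[ℝ] F) {f : ℝ → E}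
    {s : Set ℝ} (hs : UniqueDiffOn ℝ s) {n : ℕ} (hf : ContDiffOn ℝ n f s) {x : ℝ} (hx : x ∈ s) :
    iteratedDerivWithin n (fun t => L (f t)) s x = L (iteratedDerivWithin n f s x) := by
  have h := L.iteratedFDerivWithin_comp_left (hf x hx) hs hx (i := n) le_rfl
  simp only [iteratedDerivWithin]
  exact congrArg (fun φ => φ fun _ => (1 : ℝ)) h


/-- Remark 2.3 together with formula (2.5): the reduction of a regular curve in `ℙV`
(`dim V = k ≥ 3`) by the point `ℓ = ℝε(t₀)`, i.e. the curve
`η(t) = (t−t₀)⁻¹ Π(ε(t))` (`t ≠ t₀`), `η(t₀) = Π(ε'(t₀))` in `V/ℓ`, is smooth near `t₀`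
and regular near `t₀`: its derivatives of orders `0, …, k−2` form a basis of `V/ℓ`.
Here the quotient `V/ℓ` is modelled by a normed space `W` together with a surjective
linear map `Π : V → W` whose kernel is `ℓ = span{ε(t₀)}`. -/
theorem reduction_is_regular
    {V : Type*} [NormedAddCommGroup V] [NormedSpace ℝ V] [FiniteDimensional ℝ V]
    {W : Type*} [NormedAddCommGroup W] [NormedSpace ℝ W]
    (k : ℕ) (hk : 3 ≤ k) (hdim : Module.finrank ℝ V = k)
    (I : Set ℝ) (hIopen : IsOpen I) (hIconn : I.OrdConnected) (t₀ : ℝ) (ht₀ : t₀ ∈ I)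
    (ε : ℝ → V) (hε : ContDiffOn ℝ (⊤ : ℕ∞) ε I)
    (hreg : ∀ t ∈ I,
      LinearIndependent ℝ (fun i : Fin k => iteratedDerivWithin (i : ℕ) ε I t) ∧
      Submodule.span ℝ (Set.range fun i : Fin k => iteratedDerivWithin (i : ℕ) ε I t) = ⊤)
    (proj : V →ₗ[ℝ] W) (hsurj : Function.Surjective proj)
    (hker : LinearMap.ker proj = Submodule.span ℝ {ε t₀})
    (η : ℝ → W)
    (hη : ∀ t ≠ t₀, η t = (t - t₀)⁻¹ • proj (ε t))
    (hη₀ : η t₀ = proj (derivWithin ε I t₀)) :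
    ∃ J : Set ℝ, IsOpen J ∧ t₀ ∈ J ∧ J ⊆ I ∧ ContDiffOn ℝ (⊤ : ℕ∞) η J ∧
      ∀ t ∈ J,
        LinearIndependent ℝ (fun i : Fin (k - 1) => iteratedDerivWithin (i : ℕ) η J t) ∧
        Submodule.span ℝ
          (Set.range fun i : Fin (k - 1) => iteratedDerivWithin (i : ℕ) η J t) = ⊤ := by
  have : FiniteDimensional ℝ W := Module.Finite.of_surjective proj hsurj
  have : CompleteSpace W := FiniteDimensional.complete ℝ W
  have hs : UniqueDiffOn ℝ I := hIopen.uniqueDiffOn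
  let L : V →L[ℝ] W := LinearMap.toContinuousLinearMap proj
  have hLp (v : V) : L v = proj v := rfl
  have hz : proj (ε t₀) = 0 := by
    rw [← LinearMap.mem_ker, hker]
    exact Submodule.mem_span_singleton_self _
  have hf : ContDiffOn ℝ (⊤ : ℕ∞) (fun t => L (ε t)) I := L.contDiff.comp_contDiffOn hε
  have hηd : η = dslope (fun t => L (ε t)) t₀ := by
    funext t
    rcases eq_or_ne t t₀ with rfl | hne
    · have hd : HasDerivAt ε (derivWithin ε I t) t :=
        ((hε.differentiableOn (by simp)) t ht₀).hasDerivWithinAt.hasDerivAt (hIopen.mem_nhds ht₀)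
      rw [dslope_same, hη₀]
      exact (L.hasFDerivAt.comp_hasDerivAt t hd).deriv.symm
    · rw [dslope_of_ne _ hne, slope_def_module, hη t hne, hLp, hLp, hz, sub_zero]
  have hηI : ContDiffOn ℝ (⊤ : ℕ∞) η I := by
    rw [hηd]
    exact hf.dslope_of_ordConnected hIopen hIconn ht₀
  have hprod : (fun t => L (ε t)) = fun t => (t - t₀) • η t := by
    funext t
    simp [hηd, hLp, hz]
  have hderiv (i : ℕ) : proj (iteratedDerivWithin (i + 1) ε I t₀) =
      ((i : ℝ) + 1) • iteratedDerivWithin i η I t₀ := by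
    rw [← hLp, ← L.iteratedDerivWithin_comp_left hs
      (hε.of_le (by exact_mod_cast le_top)) ht₀, hprod,
      iteratedDerivWithin_succ_sub_smul hs hηI t₀ i ht₀]
    simp
  have hne : ε t₀ ≠ 0 := by
    simpa using (hreg t₀ ht₀).1.ne_zero ⟨0, by omega⟩
  have hfin : Module.finrank ℝ W = k - 1 := by
    have h := proj.finrank_range_add_finrank_ker
    rw [hker, finrank_span_singleton hne, LinearMap.range_eq_top.2 hsurj, finrank_top, hdim] at h
    omega
  have hcard : Fintype.card (Fin (k - 1)) = Module.finrank ℝ W := by simp [hfin]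
  have hspan : ⊤ ≤ Submodule.span ℝ
      (Set.range fun i : Fin (k - 1) => iteratedDerivWithin (i : ℕ) η I t₀) := by
    rw [← LinearMap.range_eq_top.2 hsurj, LinearMap.range_eq_map, ← (hreg t₀ ht₀).2,
      Submodule.map_span_le]
    rintro _ ⟨⟨j, hj⟩, rfl⟩
    rcases j with _ | i
    · simp [hz]
    · simp only [hderiv]
      exact Submodule.smul_mem _ _ (Submodule.subset_span ⟨⟨i, by omega⟩, rfl⟩)
  have hli := linearIndependent_of_top_le_span_of_card_eq_finrank hspan hcard
  have hcont : ContinuousAt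
      (fun t => fun i : Fin (k - 1) => iteratedDerivWithin (i : ℕ) η I t) t₀ :=
    continuousAt_pi.2 fun i => (hηI.continuousOn_iteratedDerivWithin
      (by exact_mod_cast le_top) hs).continuousAt (hIopen.mem_nhds ht₀)
  obtain ⟨J, hJ, hJo, htJ⟩ := eventually_nhds_iff.1
    ((hcont.eventually hli.eventually).and (hIopen.mem_nhds ht₀))
  have hJI : J ⊆ I := fun t ht => (hJ t ht).2
  refine ⟨J, hJo, htJ, hJI, hηI.mono hJI, fun t ht => ?_⟩
  have heq : (fun i : Fin (k - 1) => iteratedDerivWithin (i : ℕ) η J t) =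
      fun i : Fin (k - 1) => iteratedDerivWithin (i : ℕ) η I t :=
    funext fun i => iteratedDerivWithin_congr_right_of_isOpen η i hJo hIopen ⟨ht, hJI ht⟩
  rw [heq]
  exact ⟨(hJ t ht).1, (hJ t ht).1.span_eq_top_of_card_eq_finrank' hcard⟩
end

section
/- Let V be a real vector space of dimension 4, let I ⊆ ℝ be an open interval containing 0, and let ε : I → V be a smooth curve such that for every t ∈ I the vectors ε(t), ε'(t), ε''(t), ε⁽³⁾(t) form a basis of V and ε⁽⁴⁾(t) = B₂(t)·ε''(t) + B₁(t)·ε'(t) + B₀(t)·ε(t) for smooth functions B₀, B₁, B₂ : I → ℝ. Let ℓ = span{ε(0)}, Π : V → V/ℓ the canonical projection, and let η be the smooth curve near 0 with η(t) = t⁻¹·Π(ε(t)) for t ≠ 0 and η(0) = Π(ε'(0)). Write η(t) = Y₀(t)·Π(ε'(0)) + Y₁(t)·Π(ε''(0)) + Y₂(t)·Π(ε⁽³⁾(0)) and set α₁ = Y₁/Y₀, α₂ = Y₂/Y₀ (defined near 0 since Y₀(0) = 1). Then α₁(0) = α₂(0) = 0, α₁'(0) = 1/2, α₂'(0) = 0,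 α₁''(0) = 0, α₂''(0) = 1/3, and moreover α₁⁽³⁾(0) = B₂(0)/4, α₂⁽³⁾(0) = 0, α₂⁽⁴⁾(0) = B₂(0)/5. -/
open Filter Topology

/-- Differentiating `f t = t * Y t` at the origin shifts the jet of `Y` by one. -/
lemma iteratedDeriv_succ_zero_of_eq_id_mul {f Y : ℝ → ℝ}
    (hf : f =ᶠ[𝓝 0] fun t => t * Y t) (n : ℕ)
    (hY : ContDiffAt ℝ ((n + 1 : ℕ) : WithTop ℕ∞) Y 0) :
    iteratedDeriv (n + 1) f 0 = (n + 1) * iteratedDeriv n Y 0 := by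
  rw [hf.iteratedDeriv_eq]
  have h := iteratedDeriv_mul (n := n + 1) (x := (0 : ℝ)) (f := fun t : ℝ => t) (g := Y)
    contDiffAt_id hY
  refine h.trans ?_
  rw [Finset.sum_eq_single 1]
  · simp [iteratedDeriv_fun_id_zero]
  · intro i _ hi
    simp [iteratedDeriv_fun_id_zero, hi]
  · simp

/-- A continuous linear functional commutes with iterated derivatives along a curve. -/
lemma ContinuousLinearMap.iteratedDerivWithin_comp_apply {V : Type*} [NormedAddCommGroup V]
    [NormedSpace ℝ V] (c : V →L[ℝ] ℝ) {I : Set ℝ} (hI : UniqueDiffOn ℝ I) {ε : ℝ → V}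
    (hε : ContDiffOn ℝ (⊤ : ℕ∞) ε I) (n : ℕ) {t : ℝ} (ht : t ∈ I) :
    iteratedDerivWithin n (fun s => c (ε s)) I t = c (iteratedDerivWithin n ε I t) := by
  have h := c.iteratedFDerivWithin_comp_left (hε t ht) hI ht (i := n)
    (by exact_mod_cast le_top)
  have h' : (fun s => c (ε s)) = c ∘ ε := rfl
  simp only [iteratedDerivWithin, h', h]
  rfl

/-- The fifth derivative at the origin of a solution of a linear fourth order equation without
third order term. -/
lemma iteratedDeriv_five_of_fourth_order_ode {g b₀ b₁ b₂ : ℝ → ℝ}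
    (hg : ContDiffAt ℝ (⊤ : ℕ∞) g 0) (h₀ : ContDiffAt ℝ (⊤ : ℕ∞) b₀ 0)
    (h₁ : ContDiffAt ℝ (⊤ : ℕ∞) b₁ 0) (h₂ : ContDiffAt ℝ (⊤ : ℕ∞) b₂ 0)
    (hode : iteratedDeriv 4 g =ᶠ[𝓝 0] fun t =>
      b₂ t * iteratedDeriv 2 g t + b₁ t * iteratedDeriv 1 g t + b₀ t * iteratedDeriv 0 g t) :
    iteratedDeriv 5 g 0 =
      deriv b₂ 0 * iteratedDeriv 2 g 0 + b₂ 0 * iteratedDeriv 3 g 0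
        + (deriv b₁ 0 * iteratedDeriv 1 g 0 + b₁ 0 * iteratedDeriv 2 g 0)
        + (deriv b₀ 0 * iteratedDeriv 0 g 0 + b₀ 0 * iteratedDeriv 1 g 0) := by
  have hd (n : ℕ) : HasDerivAt (iteratedDeriv n g) (iteratedDeriv (n + 1) g 0) 0 := by
    rw [iteratedDeriv_succ]
    have h := (hg.contDiffWithinAt (s := Set.univ)).differentiableWithinAt_iteratedDerivWithin
      (m := n) (by exact_mod_cast WithTop.coe_lt_top _) (by simp)
    rw [iteratedDerivWithin_univ, differentiableWithinAt_univ] at h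
    exact h.hasDerivAt
  have hb {b : ℝ → ℝ} (h : ContDiffAt ℝ (⊤ : ℕ∞) b 0) : HasDerivAt b (deriv b 0) 0 :=
    (h.differentiableAt (by simp)).hasDerivAt
  rw [iteratedDeriv_succ, hode.deriv_eq]
  exact ((((hb h₂).mul (hd 2)).add ((hb h₁).mul (hd 1))).add ((hb h₀).mul (hd 0))).deriv

/-- If `Y` and `Z` are smooth, `Y` vanishes at the origin and `Z` agrees with `1` to second order
there, then the jet of `Y / Z` agrees with that of `Y` up to order three. -/
lemma iteratedDeriv_div_of_flat {Y Z : ℝ → ℝ}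
    (hY : ContDiffAt ℝ (⊤ : ℕ∞) Y 0) (hZ : ContDiffAt ℝ (⊤ : ℕ∞) Z 0)
    (hz₀ : Z 0 = 1) (hz₁ : iteratedDeriv 1 Z 0 = 0) (hz₂ : iteratedDeriv 2 Z 0 = 0)
    (hy₀ : Y 0 = 0) :
    iteratedDeriv 1 (fun t => Y t / Z t) 0 = iteratedDeriv 1 Y 0 ∧
    iteratedDeriv 2 (fun t => Y t / Z t) 0 = iteratedDeriv 2 Y 0 ∧
    iteratedDeriv 3 (fun t => Y t / Z t) 0 = iteratedDeriv 3 Y 0 ∧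
    iteratedDeriv 4 (fun t => Y t / Z t) 0 =
      iteratedDeriv 4 Y 0 - 4 * iteratedDeriv 1 Y 0 * iteratedDeriv 3 Z 0 := by
  have hne : Z 0 ≠ 0 := by simp [hz₀]
  have hq : ContDiffAt ℝ (⊤ : ℕ∞) (fun t => Y t / Z t) 0 := hY.div hZ hne
  have heq : (fun t => Y t / Z t) * Z =ᶠ[𝓝 0] Y := by
    filter_upwards [hZ.continuousAt.eventually_ne hne] with t ht
    simp [ht]
  have hL (n : ℕ) := (iteratedDeriv_mul (n := n) (x := (0 : ℝ))
    (hq.of_le (by exact_mod_cast le_top)) (hZ.of_le (by exact_mod_cast le_top))).symm.trans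
    (heq.iteratedDeriv_eq n)
  have l1 := hL 1
  have l2 := hL 2
  have l3 := hL 3
  have l4 := hL 4
  have c42 : Nat.choose 4 2 = 6 := rfl
  have c43 : Nat.choose 4 3 = 4 := rfl
  have c32 : Nat.choose 3 2 = 3 := rfl
  simp only [Finset.sum_range_succ, Finset.sum_range_zero, iteratedDeriv_zero, hy₀, hz₀, hz₁, hz₂,
    Nat.choose_zero_right, Nat.choose_self, Nat.choose_one_right, c42, c43, c32, Nat.sub_self,
    Nat.reduceSub, zero_div, Nat.cast_one, Nat.cast_ofNat] at l1 l2 l3 l4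
  ring_nf at l1 l2 l3 l4 ⊢
  refine ⟨l1, l2, l3, ?_⟩
  rw [← l4, ← l1]
  ring


/-- The computation after Lemma 2.1: for the reduction of a regular curve in `ℙV`
(`dim V = 4`, `ε` a canonical representative, so `ε⁽⁴⁾ = B₂ε'' + B₁ε' + B₀ε`) by the point
`ℓ = ℝε(0)`, the affine coordinates `α₁ = Y₁/Y₀`, `α₂ = Y₂/Y₀` of the reduced curve `η`
with respect to the basis `(Π(ε'(0)), Π(ε''(0)), Π(ε⁽³⁾(0)))` of `V/ℓ` satisfy
`α₁(0) = α₂(0) = 0`, `α₁'(0) = 1/2`, `α₂'(0) = 0`, `α₁''(0) = 0`, `α₂''(0) = 1/3`,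
`α₁⁽³⁾(0) = B₂(0)/4`, `α₂⁽³⁾(0) = 0`, `α₂⁽⁴⁾(0) = B₂(0)/5`.
The quotient `V/ℓ` is modelled by a normed space `W` with a surjective linear map
`proj : V → W` whose kernel is `span{ε(0)}`. -/
theorem reduction_normalization_and_jets
    {V : Type*} [NormedAddCommGroup V] [NormedSpace ℝ V] [FiniteDimensional ℝ V]
    {W : Type*} [NormedAddCommGroup W] [NormedSpace ℝ W]
    (hdim : Module.finrank ℝ V = 4)
    (I : Set ℝ) (hIopen : IsOpen I) (hIconn : I.OrdConnected) (h0I : (0 : ℝ) ∈ I)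
    (ε : ℝ → V) (hε : ContDiffOn ℝ (⊤ : ℕ∞) ε I)
    (hreg : ∀ t ∈ I,
      LinearIndependent ℝ (fun i : Fin 4 => iteratedDerivWithin (i : ℕ) ε I t) ∧
      Submodule.span ℝ (Set.range fun i : Fin 4 => iteratedDerivWithin (i : ℕ) ε I t) = ⊤)
    (B₀ B₁ B₂ : ℝ → ℝ)
    (hB₀ : ContDiffOn ℝ (⊤ : ℕ∞) B₀ I) (hB₁ : ContDiffOn ℝ (⊤ : ℕ∞) B₁ I)
    (hB₂ : ContDiffOn ℝ (⊤ : ℕ∞) B₂ I)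
    (hcan : ∀ t ∈ I, iteratedDerivWithin 4 ε I t =
      B₂ t • iteratedDerivWithin 2 ε I t + B₁ t • iteratedDerivWithin 1 ε I t
        + B₀ t • ε t)
    (proj : V →ₗ[ℝ] W) (hsurj : Function.Surjective proj)
    (hker : LinearMap.ker proj = Submodule.span ℝ {ε 0})
    (η : ℝ → W)
    (hη : ∀ t ≠ (0 : ℝ), η t = t⁻¹ • proj (ε t))
    (hη₀ : η 0 = proj (iteratedDerivWithin 1 ε I 0))
    (J : Set ℝ) (hJopen : IsOpen J) (hJconn : J.OrdConnected) (h0J : (0 : ℝ) ∈ J)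
    (hJI : J ⊆ I)
    (Y₀ Y₁ Y₂ : ℝ → ℝ)
    (hY₀ : ContDiffOn ℝ (⊤ : ℕ∞) Y₀ J) (hY₁ : ContDiffOn ℝ (⊤ : ℕ∞) Y₁ J)
    (hY₂ : ContDiffOn ℝ (⊤ : ℕ∞) Y₂ J)
    (hY : ∀ t ∈ J, η t =
      Y₀ t • proj (iteratedDerivWithin 1 ε I 0)
        + Y₁ t • proj (iteratedDerivWithin 2 ε I 0)
        + Y₂ t • proj (iteratedDerivWithin 3 ε I 0)) :
    (fun t => Y₁ t / Y₀ t) 0 = 0 ∧ (fun t => Y₂ t / Y₀ t) 0 = 0 ∧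
    iteratedDerivWithin 1 (fun t => Y₁ t / Y₀ t) J 0 = 1/2 ∧
    iteratedDerivWithin 1 (fun t => Y₂ t / Y₀ t) J 0 = 0 ∧
    iteratedDerivWithin 2 (fun t => Y₁ t / Y₀ t) J 0 = 0 ∧
    iteratedDerivWithin 2 (fun t => Y₂ t / Y₀ t) J 0 = 1/3 ∧
    iteratedDerivWithin 3 (fun t => Y₁ t / Y₀ t) J 0 = B₂ 0 / 4 ∧
    iteratedDerivWithin 3 (fun t => Y₂ t / Y₀ t) J 0 = 0 ∧
    iteratedDerivWithin 4 (fun t => Y₂ t / Y₀ t) J 0 = B₂ 0 / 5 := by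
  have hIu : UniqueDiffOn ℝ I := hIopen.uniqueDiffOn
  have hInhds : I ∈ 𝓝 (0 : ℝ) := hIopen.mem_nhds h0I
  have hJnhds : J ∈ 𝓝 (0 : ℝ) := hJopen.mem_nhds h0J
  obtain ⟨hli, hspan⟩ := hreg 0 h0I
  let b : Module.Basis (Fin 4) ℝ V := Module.Basis.mk hli hspan.ge
  have hb (i : Fin 4) : b i = iteratedDerivWithin (i : ℕ) ε I 0 := by simp [b]
  have hb0 : b 0 = ε 0 := by simp [hb]
  have hb1 : iteratedDerivWithin 1 ε I 0 = b 1 := (hb 1).symm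
  have hb2 : iteratedDerivWithin 2 ε I 0 = b 2 := (hb 2).symm
  have hb3 : iteratedDerivWithin 3 ε I 0 = b 3 := (hb 3).symm
  let c (i : Fin 4) : V →L[ℝ] ℝ := (b.coord i).toContinuousLinearMap
  have hcb (i j : Fin 4) : c i (b j) = if j = i then 1 else 0 := by
    simp [c, Finsupp.single_apply]
  have hcker (i : Fin 4) (hi : i ≠ 0) {v : V} (hv : proj v = 0) : c i v = 0 := by
    have hv' : v ∈ Submodule.span ℝ {ε 0} := hker ▸ hv
    obtain ⟨a, rfl⟩ := Submodule.mem_span_singleton.1 hv'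
    rw [map_smul, ← hb0, hcb, if_neg hi.symm, smul_zero]
  have hprojε : ∀ t ∈ J, proj (ε t - t • (Y₀ t • b 1 + Y₁ t • b 2 + Y₂ t • b 3)) = 0 := by
    intro t ht
    have h := hY t ht
    rw [hb1, hb2, hb3] at h
    rw [map_sub, map_smul, map_add, map_add, map_smul, map_smul, map_smul, ← h]
    rcases eq_or_ne t 0 with rfl | hne
    · have : ε 0 ∈ LinearMap.ker proj := hker ▸ Submodule.mem_span_singleton_self _
      simpa using this
    · rw [hη t hne, smul_inv_smul₀ hne, sub_self]
  have hcoord (i : Fin 4) (hi : i ≠ 0) : ∀ t ∈ J, c i (ε t) =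
      t * (Y₀ t * c i (b 1) + Y₁ t * c i (b 2) + Y₂ t * c i (b 3)) := by
    intro t ht
    have h := hcker i hi (hprojε t ht)
    rw [map_sub, sub_eq_zero] at h
    simpa [mul_add] using h
  have hf₀ : (fun t => c 1 (ε t)) =ᶠ[𝓝 0] fun t => t * Y₀ t := by
    filter_upwards [hJnhds] with t ht
    simp [hcoord 1 (by decide) t ht, hcb]
  have hf₁ : (fun t => c 2 (ε t)) =ᶠ[𝓝 0] fun t => t * Y₁ t := by
    filter_upwards [hJnhds] with t ht
    simp [hcoord 2 (by decide) t ht, hcb]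
  have hf₂ : (fun t => c 3 (ε t)) =ᶠ[𝓝 0] fun t => t * Y₂ t := by
    filter_upwards [hJnhds] with t ht
    simp [hcoord 3 (by decide) t ht, hcb]
  have hjet (i : Fin 4) (n : ℕ) {t : ℝ} (ht : t ∈ I) :
      iteratedDeriv n (fun s => c i (ε s)) t = c i (iteratedDerivWithin n ε I t) := by
    rw [← (c i).iteratedDerivWithin_comp_apply hIu hε n ht,
      iteratedDerivWithin_of_isOpen hIopen ht]
  have j0 (i : Fin 4) : iteratedDeriv 0 (fun s => c i (ε s)) 0 = c i (b 0) := by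
    rw [iteratedDeriv_zero, hb0]
  have j1 (i : Fin 4) : iteratedDeriv 1 (fun s => c i (ε s)) 0 = c i (b 1) := by
    rw [hjet i 1 h0I, hb1]
  have j2 (i : Fin 4) : iteratedDeriv 2 (fun s => c i (ε s)) 0 = c i (b 2) := by
    rw [hjet i 2 h0I, hb2]
  have j3 (i : Fin 4) : iteratedDeriv 3 (fun s => c i (ε s)) 0 = c i (b 3) := by
    rw [hjet i 3 h0I, hb3]
  have hode (i : Fin 4) : ∀ t ∈ I, iteratedDeriv 4 (fun s => c i (ε s)) t =
      B₂ t * iteratedDeriv 2 (fun s => c i (ε s)) t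
        + B₁ t * iteratedDeriv 1 (fun s => c i (ε s)) t
        + B₀ t * iteratedDeriv 0 (fun s => c i (ε s)) t := by
    intro t ht
    rw [hjet i 4 ht, hjet i 2 ht, hjet i 1 ht, hcan t ht]
    simp
  have j4 (i : Fin 4) : iteratedDeriv 4 (fun s => c i (ε s)) 0 =
      B₂ 0 * c i (b 2) + B₁ 0 * c i (b 1) + B₀ 0 * c i (b 0) := by
    rw [hode i 0 h0I, j0, j1, j2]
  have j5 := iteratedDeriv_five_of_fourth_order_ode
    ((c 3).contDiff.contDiffAt.comp (0 : ℝ) (hε.contDiffAt hInhds))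
    (hB₀.contDiffAt hInhds) (hB₁.contDiffAt hInhds) (hB₂.contDiffAt hInhds)
    (by filter_upwards [hInhds] with t ht using hode 3 t ht)
  change iteratedDeriv 5 (fun s => c 3 (ε s)) 0 =
    deriv B₂ 0 * iteratedDeriv 2 (fun s => c 3 (ε s)) 0
      + B₂ 0 * iteratedDeriv 3 (fun s => c 3 (ε s)) 0
      + (deriv B₁ 0 * iteratedDeriv 1 (fun s => c 3 (ε s)) 0
        + B₁ 0 * iteratedDeriv 2 (fun s => c 3 (ε s)) 0)
      + (deriv B₀ 0 * iteratedDeriv 0 (fun s => c 3 (ε s)) 0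
        + B₀ 0 * iteratedDeriv 1 (fun s => c 3 (ε s)) 0) at j5
  rw [j0, j1, j2, j3] at j5
  have sY₀ := hY₀.contDiffAt hJnhds
  have sY₁ := hY₁.contDiffAt hJnhds
  have sY₂ := hY₂.contDiffAt hJnhds
  have y₀ (n : ℕ) := iteratedDeriv_succ_zero_of_eq_id_mul hf₀ n
    (sY₀.of_le (by exact_mod_cast le_top))
  have y₁ (n : ℕ) := iteratedDeriv_succ_zero_of_eq_id_mul hf₁ n
    (sY₁.of_le (by exact_mod_cast le_top))
  have y₂ (n : ℕ) := iteratedDeriv_succ_zero_of_eq_id_mul hf₂ n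
    (sY₂.of_le (by exact_mod_cast le_top))
  have y₀0 : Y₀ 0 = 1 := by simpa [j1, hcb] using (y₀ 0).symm
  have y₀1 : iteratedDeriv 1 Y₀ 0 = 0 := by
    have h := y₀ 1
    rw [j2, hcb, if_neg (by decide)] at h
    push_cast at h
    linarith
  have y₀2 : iteratedDeriv 2 Y₀ 0 = 0 := by
    have h := y₀ 2
    rw [j3, hcb, if_neg (by decide)] at h
    push_cast at h
    linarith
  have y₁0 : Y₁ 0 = 0 := by simpa [j1, hcb] using (y₁ 0).symm
  have y₁1 : iteratedDeriv 1 Y₁ 0 = 1 / 2 := by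
    have h := y₁ 1
    rw [j2, hcb, if_pos rfl] at h
    push_cast at h
    linarith
  have y₁2 : iteratedDeriv 2 Y₁ 0 = 0 := by
    have h := y₁ 2
    rw [j3, hcb, if_neg (by decide)] at h
    push_cast at h
    linarith
  have y₁3 : iteratedDeriv 3 Y₁ 0 = B₂ 0 / 4 := by
    have h := y₁ 3
    rw [j4, hcb, hcb, hcb, if_pos rfl, if_neg (by decide), if_neg (by decide)] at h
    push_cast at h
    linarith
  have y₂0 : Y₂ 0 = 0 := by simpa [j1, hcb] using (y₂ 0).symm
  have y₂1 : iteratedDeriv 1 Y₂ 0 = 0 := by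
    have h := y₂ 1
    rw [j2, hcb, if_neg (by decide)] at h
    push_cast at h
    linarith
  have y₂2 : iteratedDeriv 2 Y₂ 0 = 1 / 3 := by
    have h := y₂ 2
    rw [j3, hcb, if_pos rfl] at h
    push_cast at h
    linarith
  have y₂3 : iteratedDeriv 3 Y₂ 0 = 0 := by
    have h := y₂ 3
    rw [j4, hcb, hcb, hcb, if_neg (by decide), if_neg (by decide), if_neg (by decide)] at h
    push_cast at h
    linarith
  have y₂4 : iteratedDeriv 4 Y₂ 0 = B₂ 0 / 5 := by
    have h := y₂ 4
    rw [j5, hcb, hcb, hcb, hcb, if_pos rfl, if_neg (by decide), if_neg (by decide),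
      if_neg (by decide)] at h
    push_cast at h
    linarith
  obtain ⟨p1, p2, p3, -⟩ := iteratedDeriv_div_of_flat sY₁ sY₀ y₀0 y₀1 y₀2 y₁0
  obtain ⟨q1, q2, q3, q4⟩ := iteratedDeriv_div_of_flat sY₂ sY₀ y₀0 y₀1 y₀2 y₂0
  simp only [iteratedDerivWithin_of_isOpen hJopen h0J]
  refine ⟨by simp [y₁0], by simp [y₂0], p1.trans y₁1, q1.trans y₂1, p2.trans y₁2, q2.trans y₂2,
    p3.trans y₁3, q3.trans y₂3, ?_⟩
  rw [q4, y₂4, y₂1]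
  ring
end

section
/- Let V be a real vector space of dimension 4, let I ⊆ ℝ be an open interval containing 0, and let ε : I → V be a smooth curve such that for every t ∈ I the vectors ε(t), ε'(t), ε''(t), ε⁽³⁾(t) form a basis of V and ε⁽⁴⁾(t) = B₂(t)·ε''(t) + B₁(t)·ε'(t) + B₀(t)·ε(t) for smooth functions B₀, B₁, B₂ : I → ℝ. Let ℓ = span{ε(0)}, Π : V → V/ℓ the canonical projection, and let η be the smooth curve near 0 with η(t) = t⁻¹·Π(ε(t)) for t ≠ 0 and η(0) = Π(ε'(0)). Write η(t) = Y₀(t)·Π(ε'(0)) + Y₁(t)·Π(ε''(0)) + Y₂(t)·Π(ε⁽³⁾(0)). Then the function t ↦ (2/3)·Y₁(t)² − (7/10)·B₂(0)·Y₂(t)² − Y₀(t)·Y₂(t) vanishes together with all its derivatives up to order 4 at t = 0. -/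
/-- Leibniz rule for `t ↦ t * f t` at the origin. -/
lemma iteratedDerivWithin_succ_id_mul_zero {s : Set ℝ} (hs : UniqueDiffOn ℝ s) (h0 : (0 : ℝ) ∈ s)
    {f : ℝ → ℝ} (hf : ContDiffOn ℝ (⊤ : ℕ∞) f s) (n : ℕ) :
    iteratedDerivWithin (n + 1) (fun t => t * f t) s 0 =
      (n + 1) * iteratedDerivWithin n f s 0 := by
  have hf' : ContDiffWithinAt ℝ ((n + 1 : ℕ) : WithTop ℕ∞) f s 0 :=
    (hf 0 h0).of_le (by exact_mod_cast le_top)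
  have key := iteratedDerivWithin_mul (n := n + 1) h0 hs (f := id) contDiffWithinAt_id hf'
  rw [show (fun t => t * f t) = id * f from rfl, key,
    Finset.sum_eq_single_of_mem 1 (by simp)]
  · simp [iteratedDerivWithin_id h0 hs]
  · intro i _ hi
    simp [iteratedDerivWithin_id h0 hs, hi]

lemma ContinuousLinearMap.iteratedDerivWithin_comp_left_apply {E F : Type*} [NormedAddCommGroup E]
    [NormedSpace ℝ E] [NormedAddCommGroup F] [NormedSpace ℝ F] (g : E →L[ℝ] F) {f : ℝ → E}
    {s : Set ℝ} {x : ℝ} (hs : UniqueDiffOn ℝ s) (hx : x ∈ s)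
    (hf : ContDiffOn ℝ (⊤ : ℕ∞) f s) (n : ℕ) :
    iteratedDerivWithin n (fun t => g (f t)) s x = g (iteratedDerivWithin n f s x) := by
  have h := g.iteratedFDerivWithin_comp_left (hf x hx) hs hx (i := n)
    (by exact_mod_cast le_top)
  simp only [iteratedDerivWithin]
  change iteratedFDerivWithin ℝ n (g ∘ f) s x _ = _
  rw [h]
  rfl

lemma ContDiffOn.hasDerivWithinAt_iteratedDerivWithin {E : Type*} [NormedAddCommGroup E]
    [NormedSpace ℝ E] {f : ℝ → E} {s : Set ℝ} {x : ℝ} (hs : UniqueDiffOn ℝ s) (hx : x ∈ s)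
    (hf : ContDiffOn ℝ (⊤ : ℕ∞) f s) (n : ℕ) :
    HasDerivWithinAt (iteratedDerivWithin n f s) (iteratedDerivWithin (n + 1) f s x) s x := by
  rw [iteratedDerivWithin_succ]
  exact (hf.differentiableOn_iteratedDerivWithin (by exact_mod_cast WithTop.coe_lt_top n) hs
    x hx).hasDerivWithinAt

/-- Differentiating a fourth order linear equation once. -/
lemma iteratedDerivWithin_five_of_linear_ode {E : Type*} [NormedAddCommGroup E]
    [NormedSpace ℝ E] {f : ℝ → E} {s : Set ℝ} {x : ℝ} (hs : UniqueDiffOn ℝ s) (hx : x ∈ s)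
    (hf : ContDiffOn ℝ (⊤ : ℕ∞) f s) {b₀ b₁ b₂ : ℝ → ℝ}
    (hb₀ : DifferentiableWithinAt ℝ b₀ s x) (hb₁ : DifferentiableWithinAt ℝ b₁ s x)
    (hb₂ : DifferentiableWithinAt ℝ b₂ s x)
    (hode : ∀ t ∈ s, iteratedDerivWithin 4 f s t =
      b₂ t • iteratedDerivWithin 2 f s t + b₁ t • iteratedDerivWithin 1 f s t + b₀ t • f t) :
    iteratedDerivWithin 5 f s x =
      (b₂ x • iteratedDerivWithin 3 f s x + derivWithin b₂ s x • iteratedDerivWithin 2 f s x)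
      + (b₁ x • iteratedDerivWithin 2 f s x + derivWithin b₁ s x • iteratedDerivWithin 1 f s x)
      + (b₀ x • iteratedDerivWithin 1 f s x + derivWithin b₀ s x • f x) := by
  have h := hf.hasDerivWithinAt_iteratedDerivWithin hs hx
  have h0 := h 0
  rw [iteratedDerivWithin_zero] at h0
  have hsum := ((hb₂.hasDerivWithinAt.smul (h 2)).add (hb₁.hasDerivWithinAt.smul (h 1))).add
    (hb₀.hasDerivWithinAt.smul h0)
  exact (hs x hx).eq_deriv _ (h 4) (hsum.congr hode (hode x hx))

/-- Contact of order four of a plane curve, given by homogeneous coordinates, with a conic. -/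
lemma iteratedDerivWithin_conic_eq_zero {s : Set ℝ} (hs : UniqueDiffOn ℝ s) {x : ℝ} (hx : x ∈ s)
    {u v w : ℝ → ℝ} (hu : ContDiffOn ℝ (⊤ : ℕ∞) u s) (hv : ContDiffOn ℝ (⊤ : ℕ∞) v s)
    (hw : ContDiffOn ℝ (⊤ : ℕ∞) w s) {b : ℝ}
    (hu0 : iteratedDerivWithin 0 u s x = 1) (hu1 : iteratedDerivWithin 1 u s x = 0)
    (hu2 : iteratedDerivWithin 2 u s x = 0)
    (hv0 : iteratedDerivWithin 0 v s x = 0) (hv1 : iteratedDerivWithin 1 v s x = 1 / 2)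
    (hv2 : iteratedDerivWithin 2 v s x = 0) (hv3 : iteratedDerivWithin 3 v s x = b / 4)
    (hw0 : iteratedDerivWithin 0 w s x = 0) (hw1 : iteratedDerivWithin 1 w s x = 0)
    (hw2 : iteratedDerivWithin 2 w s x = 1 / 3) (hw3 : iteratedDerivWithin 3 w s x = 0)
    (hw4 : iteratedDerivWithin 4 w s x = b / 5) {n : ℕ} (hn : n ≤ 4) :
    iteratedDerivWithin n
      (fun t => (2/3) * (v t)^2 - (7/10) * b * (w t)^2 - u t * w t) s x = 0 := by
  have toNat {f : ℝ → ℝ} (hf : ContDiffOn ℝ (⊤ : ℕ∞) f s) :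
      ContDiffWithinAt ℝ (n : WithTop ℕ∞) f s x :=
    (hf x hx).of_le (by exact_mod_cast le_top)
  have hu' := toNat hu
  have hv' := toNat hv
  have hw' := toNat hw
  have hvv : ContDiffWithinAt ℝ n (fun t => (2/3) * (v * v) t) s x :=
    contDiffWithinAt_const.mul (hv'.mul hv')
  have hww : ContDiffWithinAt ℝ n (fun t => ((7/10) * b) * (w * w) t) s x :=
    contDiffWithinAt_const.mul (hw'.mul hw')
  have hsub : ContDiffWithinAt ℝ n ((fun t => (2/3) * (v * v) t) -
      (fun t => ((7/10) * b) * (w * w) t)) s x := hvv.sub hww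
  have huw : ContDiffWithinAt ℝ n (u * w) s x := hu'.mul hw'
  have hexp : (fun t => (2/3) * (v t)^2 - (7/10) * b * (w t)^2 - u t * w t) =
      (fun t => (2/3) * (v * v) t) - (fun t => ((7/10) * b) * (w * w) t) - u * w := by
    funext t
    simp only [Pi.sub_apply, Pi.mul_apply]
    ring
  rw [hexp, iteratedDerivWithin_sub hx hs
      hsub
      huw,
    iteratedDerivWithin_sub hx hs hvv hww,
    iteratedDerivWithin_const_mul_field, iteratedDerivWithin_const_mul_field,
    iteratedDerivWithin_mul hx hs hv' hv', iteratedDerivWithin_mul hx hs hw' hw',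
    iteratedDerivWithin_mul hx hs hu' hw']
  interval_cases n <;>
    simp only [Finset.sum_range_succ, Finset.sum_range_zero, Nat.reduceSub, Nat.reduceAdd,
      hu0, hu1, hu2, hv0, hv1, hv2, hv3, hw0, hw1, hw2, hw3, hw4] <;>
    (norm_num [Nat.choose]; try ring)


/-- Formula (2.8): the osculating quadric at the point `Π(ε'(0))` of the reduction of a
regular curve in `ℙV` (`dim V = 4`, `ε` a canonical representative, so
`ε⁽⁴⁾ = B₂ε'' + B₁ε' + B₀ε`) by the point `ℓ = ℝε(0)` has, in the homogeneous coordinates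
`(Y₀, Y₁, Y₂)` associated with the basis `(Π(ε'(0)), Π(ε''(0)), Π(ε⁽³⁾(0)))` of `V/ℓ`, the
equation `(2/3)Y₁² − (7/10)B₂(0)Y₂² − Y₀Y₂ = 0`: its defining polynomial composed with the
reduced curve vanishes together with its derivatives up to order 4 at `t = 0`.
The quotient `V/ℓ` is modelled by a normed space `W` with a surjective linear map
`proj : V → W` whose kernel is `span{ε(0)}`. -/
theorem reduction_osculating_quadric_contact
    {V : Type*} [NormedAddCommGroup V] [NormedSpace ℝ V] [FiniteDimensional ℝ V]
    {W : Type*} [NormedAddCommGroup W] [NormedSpace ℝ W]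
    (hdim : Module.finrank ℝ V = 4)
    (I : Set ℝ) (hIopen : IsOpen I) (hIconn : I.OrdConnected) (h0I : (0 : ℝ) ∈ I)
    (ε : ℝ → V) (hε : ContDiffOn ℝ (⊤ : ℕ∞) ε I)
    (hreg : ∀ t ∈ I,
      LinearIndependent ℝ (fun i : Fin 4 => iteratedDerivWithin (i : ℕ) ε I t) ∧
      Submodule.span ℝ (Set.range fun i : Fin 4 => iteratedDerivWithin (i : ℕ) ε I t) = ⊤)
    (B₀ B₁ B₂ : ℝ → ℝ)
    (hB₀ : ContDiffOn ℝ (⊤ : ℕ∞) B₀ I) (hB₁ : ContDiffOn ℝ (⊤ : ℕ∞) B₁ I)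
    (hB₂ : ContDiffOn ℝ (⊤ : ℕ∞) B₂ I)
    (hcan : ∀ t ∈ I, iteratedDerivWithin 4 ε I t =
      B₂ t • iteratedDerivWithin 2 ε I t + B₁ t • iteratedDerivWithin 1 ε I t
        + B₀ t • ε t)
    (proj : V →ₗ[ℝ] W) (hsurj : Function.Surjective proj)
    (hker : LinearMap.ker proj = Submodule.span ℝ {ε 0})
    (η : ℝ → W)
    (hη : ∀ t ≠ (0 : ℝ), η t = t⁻¹ • proj (ε t))
    (hη₀ : η 0 = proj (iteratedDerivWithin 1 ε I 0))
    (J : Set ℝ) (hJopen : IsOpen J) (hJconn : J.OrdConnected) (h0J : (0 : ℝ) ∈ J)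
    (hJI : J ⊆ I)
    (Y₀ Y₁ Y₂ : ℝ → ℝ)
    (hY₀ : ContDiffOn ℝ (⊤ : ℕ∞) Y₀ J) (hY₁ : ContDiffOn ℝ (⊤ : ℕ∞) Y₁ J)
    (hY₂ : ContDiffOn ℝ (⊤ : ℕ∞) Y₂ J)
    (hY : ∀ t ∈ J, η t =
      Y₀ t • proj (iteratedDerivWithin 1 ε I 0)
        + Y₁ t • proj (iteratedDerivWithin 2 ε I 0)
        + Y₂ t • proj (iteratedDerivWithin 3 ε I 0)) :
    ∀ n ≤ 4, iteratedDerivWithin n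
      (fun t => (2/3) * (Y₁ t)^2 - (7/10) * B₂ 0 * (Y₂ t)^2 - Y₀ t * Y₂ t) J 0 = 0 := by
  have hI := hIopen.uniqueDiffOn (𝕜 := ℝ)
  have hJ := hJopen.uniqueDiffOn (𝕜 := ℝ)
  have hdiff {b : ℝ → ℝ} (hb : ContDiffOn ℝ (⊤ : ℕ∞) b I) : DifferentiableWithinAt ℝ b I 0 :=
    hb.differentiableOn (by simp) 0 h0I
  have h4 := hcan 0 h0I
  have h5 := iteratedDerivWithin_five_of_linear_ode hI h0I hε (hdiff hB₀) (hdiff hB₁)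
    (hdiff hB₂) hcan
  obtain ⟨hli, hspan⟩ := hreg 0 h0I
  let e := Module.Basis.mk hli hspan.ge
  let φ (i : Fin 4) : V →L[ℝ] ℝ := LinearMap.toContinuousLinearMap (e.coord i)
  have hφ (i j : Fin 4) : φ i (iteratedDerivWithin (j : ℕ) ε I 0) = if j = i then 1 else 0 := by
    have hj : iteratedDerivWithin (j : ℕ) ε I 0 = e j := by simp [e]
    rw [hj]
    simp [φ, Finsupp.single_apply]
  have hφ0 (i : Fin 4) : φ i (ε 0) = if 0 = i then 1 else 0 := by simpa using hφ i 0
  have hφ1 (i : Fin 4) : φ i (iteratedDerivWithin 1 ε I 0) = if 1 = i then 1 else 0 := hφ i 1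
  have hφ2 (i : Fin 4) : φ i (iteratedDerivWithin 2 ε I 0) = if 2 = i then 1 else 0 := hφ i 2
  have hφ3 (i : Fin 4) : φ i (iteratedDerivWithin 3 ε I 0) = if 3 = i then 1 else 0 := hφ i 3
  have hproj (t : ℝ) (ht : t ∈ J) : proj (ε t) = t • η t := by
    rcases eq_or_ne t 0 with rfl | h
    · have : ε 0 ∈ LinearMap.ker proj := hker ▸ Submodule.mem_span_singleton_self _
      simpa using this
    · rw [hη t h, smul_inv_smul₀ h]
  have hcoord (t : ℝ) (ht : t ∈ J) (i : Fin 4) (hi : i ≠ 0) :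
      φ i (ε t) = t * φ i (Y₀ t • iteratedDerivWithin 1 ε I 0
        + Y₁ t • iteratedDerivWithin 2 ε I 0 + Y₂ t • iteratedDerivWithin 3 ε I 0) := by
    have hmem : ε t - t • (Y₀ t • iteratedDerivWithin 1 ε I 0
        + Y₁ t • iteratedDerivWithin 2 ε I 0 + Y₂ t • iteratedDerivWithin 3 ε I 0)
        ∈ LinearMap.ker proj := by
      rw [LinearMap.mem_ker, map_sub, hproj t ht, hY t ht]
      simp
    rw [hker, Submodule.mem_span_singleton] at hmem
    obtain ⟨c, hc⟩ := hmem
    have := congrArg (φ i) hc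
    rw [map_smul, hφ0, if_neg hi.symm, smul_zero, map_sub, map_smul, smul_eq_mul] at this
    linarith
  have hderiv (i : Fin 4) {Y : ℝ → ℝ} (hYs : ContDiffOn ℝ (⊤ : ℕ∞) Y J)
      (hYt : ∀ t ∈ J, φ i (ε t) = t * Y t) (n : ℕ) :
      (n + 1) * iteratedDerivWithin n Y J 0 = φ i (iteratedDerivWithin (n + 1) ε I 0) := by
    rw [← iteratedDerivWithin_succ_id_mul_zero hJ h0J hYs,
      ← iteratedDerivWithin_congr (fun t ht => hYt t ht) h0J,
      (φ i).iteratedDerivWithin_comp_left_apply hJ h0J (hε.mono hJI),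
      iteratedDerivWithin_congr_right_of_isOpen ε _ hJopen hIopen ⟨h0J, h0I⟩]
  have d₀ := hderiv 1 hY₀ fun t ht => by
    rw [hcoord t ht 1 (by decide)]; simp [hφ1, hφ2, hφ3, -iteratedDerivWithin_one]
  have d₁ := hderiv 2 hY₁ fun t ht => by
    rw [hcoord t ht 2 (by decide)]; simp [hφ1, hφ2, hφ3, -iteratedDerivWithin_one]
  have d₂ := hderiv 3 hY₂ fun t ht => by
    rw [hcoord t ht 3 (by decide)]; simp [hφ1, hφ2, hφ3, -iteratedDerivWithin_one]
  have φ4 (i : Fin 4) := congrArg (φ i) h4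
  have φ5 (i : Fin 4) := congrArg (φ i) h5
  simp only [map_add, map_smul, hφ0, hφ1, hφ2, hφ3, smul_eq_mul] at φ4 φ5
  have a0 := d₀ 0
  have a1 := d₀ 1
  have a2 := d₀ 2
  have b0 := d₁ 0
  have b1 := d₁ 1
  have b2 := d₁ 2
  have b3 := d₁ 3
  have c0 := d₂ 0
  have c1 := d₂ 1
  have c2 := d₂ 2
  have c3 := d₂ 3
  have c4 := d₂ 4
  simp only [Nat.reduceAdd, zero_add, hφ1, hφ2, hφ3, φ4, φ5, Fin.reduceEq, if_true, if_false]
    at a0 a1 a2 b0 b1 b2 b3 c0 c1 c2 c3 c4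
  norm_num [-iteratedDerivWithin_zero, -iteratedDerivWithin_one]
    at a0 a1 a2 b0 b1 b2 b3 c0 c1 c2 c3 c4
  intro n hn
  apply iteratedDerivWithin_conic_eq_zero hJ h0J hY₀ hY₁ hY₂ (hn := hn) <;> linarith
end
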